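/- arXiv:2602.20771 — 7 statements merged into one kernel-verified Lean document; each statement's English description precedes it below -/
import Mathlib

section
/- Let (Ω, F, P) be a probability space, let ε be a real random variable whose law is the standard Gaussian N(0,1), and let ω be a random variable taking values in {0,1} that is independent of ε. Let r, λ_E, λ_χ, μ, γ, κ be real numbers and v > 0. Define ξ := -log E[exp(-λ_χ · ω)] and the pricing kernel Λ := exp(-r - λ_E²/2 - λ_E · ε - λ_χ · ω + ξ). If the Euler equation E[Λ · exp(γ - κ + μ + √v · ε)] = 1 holds, then μ = r + λ_E · √v - γ + κ - v/2. -/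
open MeasureTheory ProbabilityTheory

/-- Proposition 1 (ETH staking): if the Euler equation holds for the staking return
`exp(γ - κ + μ + √v ε)` under the pricing kernel
`Λ = exp(-r - λ_E²/2 - λ_E ε - λ_χ ω + ξ)`, then
`μ = r + λ_E √v - γ + κ - v/2`. -/
theorem eth_staking_restriction
    {Ω : Type*} [MeasurableSpace Ω] (P : Measure Ω) [IsProbabilityMeasure P]
    (ε ω : Ω → ℝ) (hεm : Measurable ε) (hωm : Measurable ω)
    (hεlaw : Measure.map ε P = gaussianReal 0 1)
    (hω01 : ∀ x, ω x = 0 ∨ ω x = 1)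
    (hindep : IndepFun ε ω P)
    (r lamE lamχ μ γ κ v : ℝ) (hv : 0 < v)
    (ξ : ℝ) (hξ : ξ = -Real.log (∫ x, Real.exp (-lamχ * ω x) ∂P))
    (Λ : Ω → ℝ)
    (hΛ : ∀ x, Λ x = Real.exp (-r - lamE ^ 2 / 2 - lamE * ε x - lamχ * ω x + ξ))
    (hEuler : ∫ x, Λ x * Real.exp (γ - κ + μ + Real.sqrt v * ε x) ∂P = 1) :
    μ = r + lamE * Real.sqrt v - γ + κ - v / 2 := by
  set I := ∫ x, Real.exp (-lamχ * ω x) ∂P with hI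
  have hint : Integrable (fun x => Real.exp (-lamχ * ω x)) P := by
    refine Integrable.of_bound (by fun_prop) (1 + Real.exp (-lamχ)) (ae_of_all _ fun x => ?_)
    rw [Real.norm_eq_abs, Real.abs_exp]
    rcases hω01 x with h | h
    · simpa [h] using (Real.exp_pos (-lamχ)).le
    · simp [h]
  have hI_exp : I = Real.exp (-ξ) := by
    rw [hξ, neg_neg, Real.exp_log (integral_exp_pos hint)]
  have hmgf : ∫ x, Real.exp ((Real.sqrt v - lamE) * ε x) ∂P
      = Real.exp ((Real.sqrt v - lamE) ^ 2 / 2) := by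
    simpa [mgf] using mgf_gaussianReal hεlaw (Real.sqrt v - lamE)
  have hprod := hindep.integral_fun_comp_mul_comp (f := fun y => Real.exp ((Real.sqrt v - lamE) * y))
    (g := fun y => Real.exp (-lamχ * y)) hεm.aemeasurable hωm.aemeasurable
    (by fun_prop) (by fun_prop)
  have hsplit : ∀ x, Λ x * Real.exp (γ - κ + μ + Real.sqrt v * ε x)
      = Real.exp (-r - lamE ^ 2 / 2 + ξ + γ - κ + μ)
        * (Real.exp ((Real.sqrt v - lamE) * ε x) * Real.exp (-lamχ * ω x)) := by
    intro x
    rw [hΛ, ← Real.exp_add, ← Real.exp_add, ← Real.exp_add]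
    ring_nf
  simp_rw [hsplit] at hEuler
  rw [integral_const_mul, hprod, hmgf, ← hI, hI_exp, ← Real.exp_add, ← Real.exp_add,
    Real.exp_eq_one_iff] at hEuler
  linarith [Real.sq_sqrt hv.le]
end

section
/- Let (Ω, F, P) be a probability space, let ε be a real random variable whose law is the standard Gaussian N(0,1), and let ω be a random variable taking values in {0,1} that is independent of ε. Let r, λ_E, λ_χ, μ, ψ be real numbers and v > 0. Define ξ := -log E[exp(-λ_χ · ω)] and the pricing kernel Λ := exp(-r - λ_E²/2 - λ_E · ε - λ_χ · ω + ξ). If the Euler equation E[Λ · exp(ψ + μ + √v · ε)] = 1 holds, then μ = r + λ_E · √v - ψ - v/2. -/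
open MeasureTheory ProbabilityTheory

/-- Proposition 2 (ETH lending): if the Euler equation holds for the lending return
`exp(ψ + μ + √v ε)` under the pricing kernel
`Λ = exp(-r - λ_E²/2 - λ_E ε - λ_χ ω + ξ)`, then
`μ = r + λ_E √v - ψ - v/2`. -/
theorem eth_lending_restriction
    {Ω : Type*} [MeasurableSpace Ω] (P : Measure Ω) [IsProbabilityMeasure P]
    (ε ω : Ω → ℝ) (hεm : Measurable ε) (hωm : Measurable ω)
    (hεlaw : Measure.map ε P = gaussianReal 0 1)
    (hω01 : ∀ x, ω x = 0 ∨ ω x = 1)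
    (hindep : IndepFun ε ω P)
    (r lamE lamχ μ ψ v : ℝ) (hv : 0 < v)
    (ξ : ℝ) (hξ : ξ = -Real.log (∫ x, Real.exp (-lamχ * ω x) ∂P))
    (Λ : Ω → ℝ)
    (hΛ : ∀ x, Λ x = Real.exp (-r - lamE ^ 2 / 2 - lamE * ε x - lamχ * ω x + ξ))
    (hEuler : ∫ x, Λ x * Real.exp (ψ + μ + Real.sqrt v * ε x) ∂P = 1) :
    μ = r + lamE * Real.sqrt v - ψ - v / 2 := by
  set M := ∫ x, Real.exp (-lamχ * ω x) ∂P with hM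
  set s := Real.sqrt v with hs
  have hs2 : s ^ 2 = v := Real.sq_sqrt hv.le
  have hgauss : ∫ x, Real.exp ((s - lamE) * ε x) ∂P = Real.exp ((s - lamE) ^ 2 / 2) := by
    simpa [mgf] using mgf_gaussianReal hεlaw (s - lamE)
  have hprod : ∫ x, Real.exp ((s - lamE) * ε x) * Real.exp (-lamχ * ω x) ∂P
      = Real.exp ((s - lamE) ^ 2 / 2) * M := by
    have hind : IndepFun (fun x => Real.exp ((s - lamE) * ε x))
        (fun x => Real.exp (-lamχ * ω x)) P :=
      hindep.comp (φ := fun y => Real.exp ((s - lamE) * y))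
        (ψ := fun y => Real.exp (-lamχ * y)) (by fun_prop) (by fun_prop)
    rw [hind.integral_fun_mul_eq_mul_integral (by fun_prop) (by fun_prop), hgauss]
  have hfactor : ∀ x, Λ x * Real.exp (ψ + μ + s * ε x)
      = Real.exp (-r - lamE ^ 2 / 2 + ξ + ψ + μ)
        * (Real.exp ((s - lamE) * ε x) * Real.exp (-lamχ * ω x)) := by
    intro x
    rw [hΛ, ← Real.exp_add, ← Real.exp_add, ← Real.exp_add]
    congr 1
    ring
  simp_rw [hfactor] at hEuler
  rw [integral_const_mul, hprod] at hEuler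
  have hM0 : M ≠ 0 := by
    intro h
    simp [h] at hEuler
  have hMpos : 0 < M :=
    lt_of_le_of_ne (integral_nonneg fun x => (Real.exp_pos _).le) hM0.symm
  have hMexp : M = Real.exp (-ξ) := by
    rw [hξ, neg_neg, Real.exp_log hMpos]
  rw [hMexp, ← Real.exp_add, ← Real.exp_add, Real.exp_eq_one_iff] at hEuler
  linear_combination hEuler - hs2 / 2
end

section
/- Let (Ω, F, P) be a probability space, let ε be a real random variable whose law is the standard Gaussian N(0,1), and let ω be a random variable taking values in {0,1} that is independent of ε, with P(ω = 1) = 1 - p₀₀ where 0 ≤ p₀₀ ≤ 1. Let r, λ_E, λ_χ, μ, γˢ, ψˢ be real numbers, v > 0, and η > 0. Define ξ := -log E[exp(-λ_χ · ω)], the pricing kernel Λ := exp(-r - λ_E²/2 - λ_E · ε - λ_χ · ω + ξ), the risk-adjusted probability p̃₀₀ := p₀₀ / (p₀₀ + (1 - p₀₀) · e^{-λ_χ}), and the risk-adjusted peg premium η̃ := -log(e^{-η} + p̃₀₀ · (1 - e^{-η})). If the Euler equation E[Λ · exp(γˢ + ψˢ + μ + √v · ε - η · ω)] = 1 holds, then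 μ = r + λ_E · √v + η̃ - γˢ - ψˢ - v/2. -/
open MeasureTheory ProbabilityTheory

/-- The moment generating function of a `{0, 1}`-valued random variable. -/
lemma mgf_of_eq_zero_or_eq_one {Ω : Type*} [MeasurableSpace Ω] {P : Measure Ω}
    [IsProbabilityMeasure P] {X : Ω → ℝ} (hX : Measurable X) (h01 : ∀ x, X x = 0 ∨ X x = 1)
    (t : ℝ) :
    mgf X P t = 1 - P.real {x | X x = 1} + P.real {x | X x = 1} * Real.exp t := by
  have hs : MeasurableSet {x | X x = 1} := hX (measurableSet_singleton 1)
  have hexp : ∀ x, Real.exp (t * X x)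
      = 1 + {x | X x = 1}.indicator (fun _ => Real.exp t - 1) x := by
    intro x
    rcases h01 x with h | h <;> simp [Set.indicator, h]
  rw [mgf, integral_congr_ae (.of_forall hexp),
    integral_add (integrable_const _) ((integrable_const _).indicator hs),
    integral_indicator_const _ hs]
  simp only [integral_const, probReal_univ, smul_eq_mul]
  ring

/-- Proposition 3 (stETH investment), parity state: if the Euler equation holds for
the liquid-staking return `exp(γˢ + ψˢ + μ + √v ε - η ω)` under the pricing kernel
`Λ = exp(-r - λ_E²/2 - λ_E ε - λ_χ ω + ξ)`, with `P(ω = 1) = 1 - p₀₀` and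
risk-adjusted peg premium `η̃ = -log(e^{-η} + p̃₀₀ (1 - e^{-η}))`, then
`μ = r + λ_E √v + η̃ - γˢ - ψˢ - v/2`. -/
theorem steth_restriction_parity
    {Ω : Type*} [MeasurableSpace Ω] (P : Measure Ω) [IsProbabilityMeasure P]
    (ε ω : Ω → ℝ) (hεm : Measurable ε) (hωm : Measurable ω)
    (hεlaw : Measure.map ε P = gaussianReal 0 1)
    (hω01 : ∀ x, ω x = 0 ∨ ω x = 1)
    (hindep : IndepFun ε ω P)
    (p00 : ℝ) (hp0 : 0 ≤ p00) (hp1 : p00 ≤ 1)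
    (hPω : P {x | ω x = 1} = ENNReal.ofReal (1 - p00))
    (r lamE lamχ μ γs ψs v η : ℝ) (hv : 0 < v) (hη : 0 < η)
    (ξ : ℝ) (hξ : ξ = -Real.log (∫ x, Real.exp (-lamχ * ω x) ∂P))
    (Λ : Ω → ℝ)
    (hΛ : ∀ x, Λ x = Real.exp (-r - lamE ^ 2 / 2 - lamE * ε x - lamχ * ω x + ξ))
    (ptilde : ℝ) (hpt : ptilde = p00 / (p00 + (1 - p00) * Real.exp (-lamχ)))
    (ηtilde : ℝ)
    (hηt : ηtilde = -Real.log (Real.exp (-η) + ptilde * (1 - Real.exp (-η))))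
    (hEuler : ∫ x, Λ x * Real.exp (γs + ψs + μ + Real.sqrt v * ε x - η * ω x) ∂P = 1) :
    μ = r + lamE * Real.sqrt v + ηtilde - γs - ψs - v / 2 := by
  have hreal : P.real {x | ω x = 1} = 1 - p00 := by
    rw [measureReal_def, hPω, ENNReal.toReal_ofReal (by linarith)]
  have hmgf : ∀ t, mgf ω P t = p00 + (1 - p00) * Real.exp t := by
    intro t
    rw [mgf_of_eq_zero_or_eq_one hωm hω01, hreal]
    ring
  have hpos : ∀ t : ℝ, 0 < p00 + (1 - p00) * Real.exp t := by
    intro t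
    rcases hp0.eq_or_lt with h | h
    · simp [← h, Real.exp_pos]
    · have := mul_nonneg (sub_nonneg.2 hp1) (Real.exp_pos t).le
      linarith
  have hξ' : ξ = -Real.log (p00 + (1 - p00) * Real.exp (-lamχ)) := by
    rw [hξ, ← hmgf]
    rfl
  have hηt' : ηtilde = Real.log (p00 + (1 - p00) * Real.exp (-lamχ))
      - Real.log (p00 + (1 - p00) * Real.exp (-lamχ - η)) := by
    have hD := (hpos (-lamχ)).ne'
    have hquot : Real.exp (-η) + ptilde * (1 - Real.exp (-η))
        = (p00 + (1 - p00) * Real.exp (-lamχ - η)) / (p00 + (1 - p00) * Real.exp (-lamχ)) := by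
      rw [hpt, sub_eq_add_neg (-lamχ) η, Real.exp_add]
      field_simp
      ring
    rw [hηt, hquot, Real.log_div (hpos _).ne' hD]
    ring
  have hsplit : ∀ x, Λ x * Real.exp (γs + ψs + μ + Real.sqrt v * ε x - η * ω x)
      = Real.exp (-r - lamE ^ 2 / 2 + ξ + γs + ψs + μ)
        * (Real.exp ((Real.sqrt v - lamE) * ε x) * Real.exp ((-lamχ - η) * ω x)) := by
    intro x
    rw [hΛ, ← Real.exp_add, ← Real.exp_add, ← Real.exp_add]
    ring_nf
  have hprod : ∫ x, Real.exp ((Real.sqrt v - lamE) * ε x) * Real.exp ((-lamχ - η) * ω x) ∂P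
      = mgf ε P (Real.sqrt v - lamE) * mgf ω P (-lamχ - η) :=
    (hindep.exp_mul _ _).integral_fun_mul_eq_mul_integral
      (by fun_prop) (by fun_prop)
  rw [integral_congr_ae (.of_forall hsplit), integral_const_mul, hprod,
    mgf_gaussianReal hεlaw, hmgf] at hEuler
  have hlog := congrArg Real.log hEuler
  rw [Real.log_mul (Real.exp_pos _).ne' (mul_pos (Real.exp_pos _) (hpos _)).ne',
    Real.log_mul (Real.exp_pos _).ne' (hpos _).ne', Real.log_exp, Real.log_exp,
    Real.log_one] at hlog
  have hsq := Real.sq_sqrt hv.le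
  push_cast at hlog
  rw [hηt']
  rw [hξ'] at hlog
  linear_combination hlog - hsq / 2
end

section
/- Let (Ω, F, P) be a probability space, let ε be a real random variable whose law is the standard Gaussian N(0,1), and let ω be a random variable taking values in {0,1} that is independent of ε, with P(ω = 1) = p_{ηη} where 0 ≤ p_{ηη} ≤ 1. Let r, λ_E, λ_χ, μ, γˢ, ψˢ be real numbers, v > 0, and η > 0. Define ξ := -log E[exp(-λ_χ · ω)], the pricing kernel Λ := exp(-r - λ_E²/2 - λ_E · ε - λ_χ · ω + ξ), the risk-adjusted probability p̃_{ηη} := p_{ηη} · e^{-λ_χ} / (p_{ηη} · e^{-λ_χ} + (1 - p_{ηη})), and the risk-adjusted peg premium η̃ := -log(e^{η} - p̃_{ηη} · (e^{η} - 1)). If the Euler equation E[Λ · exp(γˢ + ψˢ + μ + √v · ε - η · ω + η)] = 1 holds, then μ = r + λ_E · √v + η̃ - γˢ - ψˢ - v/2. -/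
open MeasureTheory ProbabilityTheory

/-- The moment generating function of a Bernoulli random variable. -/
theorem mgf_of_zero_or_one {Ω : Type*} [MeasurableSpace Ω] {P : Measure Ω}
    [IsProbabilityMeasure P] {X : Ω → ℝ} (hX : Measurable X) (hX01 : ∀ x, X x = 0 ∨ X x = 1)
    {p : ℝ} (hp : 0 ≤ p) (hPX : P {x | X x = 1} = ENNReal.ofReal p) (t : ℝ) :
    mgf X P t = p * Real.exp t + (1 - p) := by
  have hS : MeasurableSet {x | X x = 1} := hX (measurableSet_singleton 1)
  have hexp : ∀ x, Real.exp (t * X x) =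
      1 + {x | X x = 1}.indicator (fun _ => Real.exp t - 1) x := by
    intro x
    rcases hX01 x with h | h <;> simp [Set.indicator, h]
  have hint : Integrable ({x | X x = 1}.indicator (fun _ => Real.exp t - 1)) P :=
    (integrable_const _).indicator hS
  simp only [mgf, hexp]
  rw [integral_add (integrable_const _) hint, integral_indicator_const _ hS, measureReal_def, hPX,
    ENNReal.toReal_ofReal hp]
  simp only [integral_const, probReal_univ, smul_eq_mul]
  ring

/-- Proposition 3 (stETH investment), de-peg state: if the Euler equation holds for
the liquid-staking return `exp(γˢ + ψˢ + μ + √v ε - η ω + η)` under the pricing kernel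
`Λ = exp(-r - λ_E²/2 - λ_E ε - λ_χ ω + ξ)`, with `P(ω = 1) = p_{ηη}` and
risk-adjusted peg premium `η̃ = -log(e^{η} - p̃_{ηη} (e^{η} - 1))`, then
`μ = r + λ_E √v + η̃ - γˢ - ψˢ - v/2`. -/
theorem steth_restriction_depeg
    {Ω : Type*} [MeasurableSpace Ω] (P : Measure Ω) [IsProbabilityMeasure P]
    (ε ω : Ω → ℝ) (hεm : Measurable ε) (hωm : Measurable ω)
    (hεlaw : Measure.map ε P = gaussianReal 0 1)
    (hω01 : ∀ x, ω x = 0 ∨ ω x = 1)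
    (hindep : IndepFun ε ω P)
    (pηη : ℝ) (hp0 : 0 ≤ pηη) (hp1 : pηη ≤ 1)
    (hPω : P {x | ω x = 1} = ENNReal.ofReal pηη)
    (r lamE lamχ μ γs ψs v η : ℝ) (hv : 0 < v) (hη : 0 < η)
    (ξ : ℝ) (hξ : ξ = -Real.log (∫ x, Real.exp (-lamχ * ω x) ∂P))
    (Λ : Ω → ℝ)
    (hΛ : ∀ x, Λ x = Real.exp (-r - lamE ^ 2 / 2 - lamE * ε x - lamχ * ω x + ξ))
    (ptilde : ℝ)
    (hpt : ptilde = pηη * Real.exp (-lamχ) / (pηη * Real.exp (-lamχ) + (1 - pηη)))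
    (ηtilde : ℝ)
    (hηt : ηtilde = -Real.log (Real.exp η - ptilde * (Real.exp η - 1)))
    (hEuler :
      ∫ x, Λ x * Real.exp (γs + ψs + μ + Real.sqrt v * ε x - η * ω x + η) ∂P = 1) :
    μ = r + lamE * Real.sqrt v + ηtilde - γs - ψs - v / 2 := by
  have hmgf := mgf_of_zero_or_one hωm hω01 hp0 hPω
  set D : ℝ := pηη * Real.exp (-lamχ) + (1 - pηη) with hD
  have hcombo : ∀ a b : ℝ, 0 < a → 0 < b → 0 < pηη * a + (1 - pηη) * b := by
    intro a b ha hb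
    rcases hp0.eq_or_lt with h | h
    · simpa [← h] using hb
    · have := mul_pos h ha
      have := mul_nonneg (sub_nonneg.2 hp1) hb.le
      linarith
  have hDpos : 0 < D := by
    simpa [hD] using hcombo (Real.exp (-lamχ)) 1 (Real.exp_pos _) one_pos
  have hξD : Real.exp ξ = D⁻¹ := by
    have h : ∫ x, Real.exp (-lamχ * ω x) ∂P = D := hmgf (-lamχ)
    rw [hξ, h, Real.exp_neg, Real.exp_log hDpos]
  have hpremium : Real.exp η - ptilde * (Real.exp η - 1) =
      (pηη * Real.exp (-lamχ) + (1 - pηη) * Real.exp η) / D := by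
    rw [hpt, eq_div_iff hDpos.ne', sub_mul, mul_right_comm, div_mul_cancel₀ _ hDpos.ne', hD]
    ring
  have hpremium_pos : 0 < Real.exp η - ptilde * (Real.exp η - 1) := by
    rw [hpremium]
    exact div_pos (hcombo _ _ (Real.exp_pos _) (Real.exp_pos _)) hDpos
  have hexp_premium : Real.exp (-ηtilde) =
      Real.exp ξ * Real.exp η * mgf ω P (-(lamχ + η)) := by
    have hcancel : Real.exp η * Real.exp (-(lamχ + η)) = Real.exp (-lamχ) := by
      rw [← Real.exp_add]
      congr 1
      ring
    rw [hηt, neg_neg, Real.exp_log hpremium_pos, hpremium, hξD, hmgf, ← hcancel, div_eq_inv_mul]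
    ring
  have hgauss := mgf_gaussianReal hεlaw (Real.sqrt v - lamE)
  have hprod : mgf ε P (Real.sqrt v - lamE) * mgf ω P (-(lamχ + η)) =
      ∫ x, Real.exp ((Real.sqrt v - lamE) * ε x) * Real.exp (-(lamχ + η) * ω x) ∂P :=
    ((hindep.exp_mul _ _).integral_fun_mul_eq_mul_integral
      (by fun_prop) (by fun_prop)).symm
  have hfactor : ∀ x, Λ x * Real.exp (γs + ψs + μ + Real.sqrt v * ε x - η * ω x + η) =
      Real.exp (-r - lamE ^ 2 / 2 + γs + ψs + μ + ξ + η) *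
        (Real.exp ((Real.sqrt v - lamE) * ε x) * Real.exp (-(lamχ + η) * ω x)) := by
    intro x
    rw [hΛ, ← Real.exp_add, ← Real.exp_add, ← Real.exp_add]
    congr 1
    ring
  have hsum : Real.exp (-r - lamE ^ 2 / 2 + γs + ψs + μ + (Real.sqrt v - lamE) ^ 2 / 2 - ηtilde)
      = 1 := by
    rw [← hEuler]
    simp only [hfactor]
    rw [integral_const_mul, ← hprod, hgauss, sub_eq_add_neg _ ηtilde, Real.exp_add _ (-ηtilde),
      hexp_premium, Real.exp_add _ η, Real.exp_add _ ξ, Real.exp_add _ (_ / 2)]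
    simp only [NNReal.coe_one, one_mul, zero_mul, zero_add]
    ring
  rw [Real.exp_eq_one_iff] at hsum
  have hsq := Real.sq_sqrt hv.le
  linear_combination hsum - hsq / 2
end

section
/- Let (Ω, F, P) be a probability space, let ε be a real random variable whose law is the standard Gaussian N(0,1), and let ω be a random variable taking values in {0,1} that is independent of ε, with P(ω = 1) = 1 - p₀₀ where 0 ≤ p₀₀ ≤ 1. Let r, λ_E, λ_χ, μ, γ, γˢ, ψˢ, κ be real numbers, v > 0, and η > 0. Define ξ := -log E[exp(-λ_χ · ω)], the pricing kernel Λ := exp(-r - λ_E²/2 - λ_E · ε - λ_χ · ω + ξ), the risk-adjusted probability p̃₀₀ := p₀₀ / (p₀₀ + (1 - p₀₀) · e^{-λ_χ}), and the risk-adjusted peg premium η̃ := -log(e^{-η} + p̃₀₀ · (1 - e^{-η})). If both Euler equations E[Λ · exp(γ - κ + μ + √v · ε)] = 1 and E[Λ · exp(γˢ + ψˢ + μ + √v · ε - η · ω)] = 1 hold, then ψˢ = γ - γˢ + η̃ - κ. -/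
open MeasureTheory ProbabilityTheory

/-- The moment generating function of a Bernoulli variable with `P(ω = 1) = 1 - p`. -/
lemma integral_exp_mul_bernoulli {Ω : Type*} [MeasurableSpace Ω] (P : Measure Ω)
    [IsProbabilityMeasure P] {ω : Ω → ℝ} (hω : Measurable ω)
    (hω01 : ∀ x, ω x = 0 ∨ ω x = 1) {p : ℝ} (hp : p ≤ 1)
    (hPω : P {x | ω x = 1} = ENNReal.ofReal (1 - p)) (a : ℝ) :
    ∫ x, Real.exp (a * ω x) ∂P = p + (1 - p) * Real.exp a := by
  have hS : MeasurableSet {x | ω x = 1} := hω (measurableSet_singleton 1)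
  have hexp : ∀ x, Real.exp (a * ω x)
      = 1 + Set.indicator {x | ω x = 1} (fun _ ↦ Real.exp a - 1) x := fun x ↦ by
    rcases hω01 x with h | h <;> simp [h]
  simp_rw [hexp]
  rw [integral_add (integrable_const _) ((integrable_const _).indicator hS),
    integral_indicator_const _ hS, measureReal_def, hPω, ENNReal.toReal_ofReal (by linarith)]
  simp only [integral_const, probReal_univ, smul_eq_mul]
  ring

/-- The exponential moment of an affine combination of `ε` and an independent Bernoulli `ω`. -/
lemma integral_exp_affine_bernoulli {Ω : Type*} [MeasurableSpace Ω] (P : Measure Ω)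
    [IsProbabilityMeasure P] {ε ω : Ω → ℝ} (hε : Measurable ε) (hω : Measurable ω)
    (hω01 : ∀ x, ω x = 0 ∨ ω x = 1) (hindep : IndepFun ε ω P) {p : ℝ} (hp : p ≤ 1)
    (hPω : P {x | ω x = 1} = ENNReal.ofReal (1 - p)) (c a b : ℝ) :
    ∫ x, Real.exp (c + b * ε x + a * ω x) ∂P
      = Real.exp c * (∫ x, Real.exp (b * ε x) ∂P) * (p + (1 - p) * Real.exp a) := by
  simp_rw [Real.exp_add, mul_assoc, integral_const_mul]
  rw [hindep.integral_fun_comp_mul_comp (f := fun t ↦ Real.exp (b * t))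
      (g := fun t ↦ Real.exp (a * t)) hε.aemeasurable hω.aemeasurable (by fun_prop) (by fun_prop),
    integral_exp_mul_bernoulli P hω hω01 hp hPω]

/-- Proposition 4 (stETH lending vs. ETH staking), parity state: if the Euler
equations hold for both the direct-staking return `exp(γ - κ + μ + √v ε)` and the
liquid-staking return `exp(γˢ + ψˢ + μ + √v ε - η ω)` under the pricing kernel
`Λ = exp(-r - λ_E²/2 - λ_E ε - λ_χ ω + ξ)`, then `ψˢ = γ - γˢ + η̃ - κ`. -/
theorem steth_vs_staking_parity
    {Ω : Type*} [MeasurableSpace Ω] (P : Measure Ω) [IsProbabilityMeasure P]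
    (ε ω : Ω → ℝ) (hεm : Measurable ε) (hωm : Measurable ω)
    (hεlaw : Measure.map ε P = gaussianReal 0 1)
    (hω01 : ∀ x, ω x = 0 ∨ ω x = 1)
    (hindep : IndepFun ε ω P)
    (p00 : ℝ) (hp0 : 0 ≤ p00) (hp1 : p00 ≤ 1)
    (hPω : P {x | ω x = 1} = ENNReal.ofReal (1 - p00))
    (r lamE lamχ μ γ γs ψs κ v η : ℝ) (hv : 0 < v) (hη : 0 < η)
    (ξ : ℝ) (hξ : ξ = -Real.log (∫ x, Real.exp (-lamχ * ω x) ∂P))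
    (Λ : Ω → ℝ)
    (hΛ : ∀ x, Λ x = Real.exp (-r - lamE ^ 2 / 2 - lamE * ε x - lamχ * ω x + ξ))
    (ptilde : ℝ) (hpt : ptilde = p00 / (p00 + (1 - p00) * Real.exp (-lamχ)))
    (ηtilde : ℝ)
    (hηt : ηtilde = -Real.log (Real.exp (-η) + ptilde * (1 - Real.exp (-η))))
    (hEuler1 : ∫ x, Λ x * Real.exp (γ - κ + μ + Real.sqrt v * ε x) ∂P = 1)
    (hEuler2 : ∫ x, Λ x * Real.exp (γs + ψs + μ + Real.sqrt v * ε x - η * ω x) ∂P = 1) :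
    ψs = γ - γs + ηtilde - κ := by
  have h1 := integral_exp_affine_bernoulli P hεm hωm hω01 hindep hp1 hPω
    (-r - lamE ^ 2 / 2 + ξ + γ - κ + μ) (-lamχ) (Real.sqrt v - lamE)
  have h2 := integral_exp_affine_bernoulli P hεm hωm hω01 hindep hp1 hPω
    (-r - lamE ^ 2 / 2 + ξ + γs + ψs + μ) (-lamχ - η) (Real.sqrt v - lamE)
  have e1 : ∫ x, Real.exp (-r - lamE ^ 2 / 2 + ξ + γ - κ + μ + (Real.sqrt v - lamE) * ε x
      + -lamχ * ω x) ∂P = 1 := by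
    rw [← hEuler1]
    congr 1 with x
    rw [hΛ, ← Real.exp_add]
    ring_nf
  have e2 : ∫ x, Real.exp (-r - lamE ^ 2 / 2 + ξ + γs + ψs + μ + (Real.sqrt v - lamE) * ε x
      + (-lamχ - η) * ω x) ∂P = 1 := by
    rw [← hEuler2]
    congr 1 with x
    rw [hΛ, ← Real.exp_add]
    ring_nf
  rw [e1] at h1
  rw [e2] at h2
  set I := ∫ x, Real.exp ((Real.sqrt v - lamE) * ε x) ∂P
  have hM : 0 < p00 + (1 - p00) * Real.exp (-lamχ) := by
    rcases hp0.eq_or_lt with h | h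
    · simp [← h, Real.exp_pos]
    · have := mul_nonneg (sub_nonneg.2 hp1) (Real.exp_pos (-lamχ)).le
      linarith
  have hI : I ≠ 0 := by
    intro h
    simp [h] at h1
  have hpremium : Real.exp (-η) + ptilde * (1 - Real.exp (-η))
      = Real.exp (γ - κ - γs - ψs) := by
    have hC : Real.exp (-r - lamE ^ 2 / 2 + ξ + γ - κ + μ)
        = Real.exp (-r - lamE ^ 2 / 2 + ξ + γs + ψs + μ) * Real.exp (γ - κ - γs - ψs) := by
      rw [← Real.exp_add]
      ring_nf
    rw [hC] at h1
    have hM2 : p00 + (1 - p00) * Real.exp (-lamχ - η)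
        = Real.exp (γ - κ - γs - ψs) * (p00 + (1 - p00) * Real.exp (-lamχ)) := by
      refine mul_left_cancel₀ (mul_ne_zero (Real.exp_pos
        (-r - lamE ^ 2 / 2 + ξ + γs + ψs + μ)).ne' hI) ?_
      linear_combination h1 - h2
    rw [sub_eq_add_neg (-lamχ), Real.exp_add] at hM2
    refine mul_right_cancel₀ hM.ne' ?_
    rw [hpt, ← hM2]
    field_simp
    ring
  rw [hηt, hpremium, Real.log_exp]
  ring
end

section
/- Let (Ω, F, P) be a probability space, let ε be a real random variable whose law is the standard Gaussian N(0,1), and let ω be a random variable taking values in {0,1} that is independent of ε, with P(ω = 1) = p_{ηη} where 0 ≤ p_{ηη} ≤ 1. Let r, λ_E, λ_χ, μ, γ, γˢ, ψˢ, κ be real numbers, v > 0, and η > 0. Define ξ := -log E[exp(-λ_χ · ω)], the pricing kernel Λ := exp(-r - λ_E²/2 - λ_E · ε - λ_χ · ω + ξ), the risk-adjusted probability p̃_{ηη} := p_{ηη} · e^{-λ_χ} / (p_{ηη} · e^{-λ_χ} + (1 - p_{ηη})), and the risk-adjusted peg premium η̃ := -log(e^{η} - p̃_{ηη} · (e^{η}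 - 1)). If both Euler equations E[Λ · exp(γ - κ + μ + √v · ε)] = 1 and E[Λ · exp(γˢ + ψˢ + μ + √v · ε - η · ω + η)] = 1 hold, then ψˢ = γ - γˢ + η̃ - κ. -/
open MeasureTheory ProbabilityTheory

/-- The moment generating function of a Bernoulli random variable. -/
theorem integral_exp_mul_of_zero_or_one {Ω : Type*} [MeasurableSpace Ω] {P : Measure Ω}
    [IsProbabilityMeasure P] {ω : Ω → ℝ} (hωm : Measurable ω)
    (hω01 : ∀ x, ω x = 0 ∨ ω x = 1) {p : ℝ} (hp0 : 0 ≤ p)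
    (hPω : P {x | ω x = 1} = ENNReal.ofReal p) (a : ℝ) :
    ∫ x, Real.exp (a * ω x) ∂P = p * Real.exp a + (1 - p) := by
  have hS : MeasurableSet {x | ω x = 1} := hωm (measurableSet_singleton 1)
  have hexp : ∀ x, Real.exp (a * ω x) =
      1 + (Real.exp a - 1) * Set.indicator {x | ω x = 1} (1 : Ω → ℝ) x := by
    intro x
    rcases hω01 x with h | h <;> simp [Set.indicator, h]
  have hint : Integrable (Set.indicator {x | ω x = 1} (1 : Ω → ℝ)) P :=
    (integrable_const (1 : ℝ)).indicator hS
  simp_rw [hexp]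
  rw [integral_add (integrable_const _) (hint.const_mul _), integral_const_mul,
    integral_indicator_one hS, measureReal_def, hPω, ENNReal.toReal_ofReal hp0]
  simp
  ring

/-- The joint exponential moment of two independent random variables factorizes. -/
theorem integral_exp_add_mul_add_mul_of_indepFun {Ω : Type*} [MeasurableSpace Ω]
    {P : Measure Ω} {X Y : Ω → ℝ} (hX : Measurable X) (hY : Measurable Y)
    (hXY : IndepFun X Y P) (c s t : ℝ) :
    ∫ x, Real.exp (c + s * X x + t * Y x) ∂P =
      Real.exp c * ((∫ x, Real.exp (s * X x) ∂P) * ∫ x, Real.exp (t * Y x) ∂P) := by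
  have hmul := hXY.integral_comp_mul_comp (f := fun y => Real.exp (s * y))
    (g := fun y => Real.exp (t * y)) hX.aemeasurable hY.aemeasurable
    (by fun_prop) (by fun_prop)
  simp only [Real.exp_add, mul_assoc, integral_const_mul]
  exact congrArg _ hmul

/-- Proposition 4 (stETH lending vs. ETH staking), de-peg state: if the Euler
equations hold for both the direct-staking return `exp(γ - κ + μ + √v ε)` and the
liquid-staking return `exp(γˢ + ψˢ + μ + √v ε - η ω + η)` under the pricing kernel
`Λ = exp(-r - λ_E²/2 - λ_E ε - λ_χ ω + ξ)`, then `ψˢ = γ - γˢ + η̃ - κ`. -/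
theorem steth_vs_staking_depeg
    {Ω : Type*} [MeasurableSpace Ω] (P : Measure Ω) [IsProbabilityMeasure P]
    (ε ω : Ω → ℝ) (hεm : Measurable ε) (hωm : Measurable ω)
    (hεlaw : Measure.map ε P = gaussianReal 0 1)
    (hω01 : ∀ x, ω x = 0 ∨ ω x = 1)
    (hindep : IndepFun ε ω P)
    (pηη : ℝ) (hp0 : 0 ≤ pηη) (hp1 : pηη ≤ 1)
    (hPω : P {x | ω x = 1} = ENNReal.ofReal pηη)
    (r lamE lamχ μ γ γs ψs κ v η : ℝ) (hv : 0 < v) (hη : 0 < η)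
    (ξ : ℝ) (hξ : ξ = -Real.log (∫ x, Real.exp (-lamχ * ω x) ∂P))
    (Λ : Ω → ℝ)
    (hΛ : ∀ x, Λ x = Real.exp (-r - lamE ^ 2 / 2 - lamE * ε x - lamχ * ω x + ξ))
    (ptilde : ℝ)
    (hpt : ptilde = pηη * Real.exp (-lamχ) / (pηη * Real.exp (-lamχ) + (1 - pηη)))
    (ηtilde : ℝ)
    (hηt : ηtilde = -Real.log (Real.exp η - ptilde * (Real.exp η - 1)))
    (hEuler1 : ∫ x, Λ x * Real.exp (γ - κ + μ + Real.sqrt v * ε x) ∂P = 1)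
    (hEuler2 :
      ∫ x, Λ x * Real.exp (γs + ψs + μ + Real.sqrt v * ε x - η * ω x + η) ∂P = 1) :
    ψs = γ - γs + ηtilde - κ := by
  have hbern := integral_exp_mul_of_zero_or_one hωm hω01 hp0 hPω
  have hfact := integral_exp_add_mul_add_mul_of_indepFun hεm hωm hindep
  set c := -r - lamE ^ 2 / 2 + ξ + μ with hc
  set G := ∫ x, Real.exp ((Real.sqrt v - lamE) * ε x) ∂P with hG
  have h1 : Real.exp (c + (γ - κ)) * (G * (pηη * Real.exp (-lamχ) + (1 - pηη))) = 1 := by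
    rw [← hbern, hG, ← hfact, ← hEuler1]
    congr 1 with x
    rw [hΛ, ← Real.exp_add, hc]
    ring_nf
  have h2 : Real.exp (c + (γs + ψs + η)) *
      (G * (pηη * Real.exp (-lamχ - η) + (1 - pηη))) = 1 := by
    rw [← hbern, hG, ← hfact, ← hEuler2]
    congr 1 with x
    rw [hΛ, ← Real.exp_add, hc]
    ring_nf
  have hweight : ∀ a b : ℝ, 0 < a → 0 < b → 0 < pηη * a + (1 - pηη) * b := by
    intro a b ha hb
    rcases hp0.eq_or_lt with h | h
    · simpa [← h] using hb
    · have := mul_pos h ha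
      have := mul_nonneg (sub_nonneg.2 hp1) hb.le
      linarith
  have hD : 0 < pηη * Real.exp (-lamχ) + (1 - pηη) := by
    simpa using hweight _ 1 (Real.exp_pos (-lamχ)) one_pos
  have hN := hweight _ _ (Real.exp_pos (-lamχ)) (Real.exp_pos η)
  have hQ : Real.exp η - ptilde * (Real.exp η - 1) =
      (pηη * Real.exp (-lamχ) + (1 - pηη) * Real.exp η) /
        (pηη * Real.exp (-lamχ) + (1 - pηη)) := by
    rw [hpt]
    field_simp
    ring
  have hG0 : G ≠ 0 := by
    intro h
    simp [h] at h1
  have hcG : Real.exp c * G ≠ 0 := mul_ne_zero (Real.exp_ne_zero c) hG0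
  have hη' : Real.exp η * Real.exp (-lamχ - η) = Real.exp (-lamχ) := by
    rw [← Real.exp_add]
    ring_nf
  have hratio : Real.exp (γs + ψs) * (pηη * Real.exp (-lamχ) + (1 - pηη) * Real.exp η) =
      Real.exp (γ - κ) * (pηη * Real.exp (-lamχ) + (1 - pηη)) := by
    apply mul_left_cancel₀ hcG
    rw [Real.exp_add c] at h1 h2
    rw [Real.exp_add _ η] at h2
    linear_combination h2 - h1 - Real.exp c * G * Real.exp (γs + ψs) * pηη * hη'
  have hlog := congrArg Real.log hratio
  rw [Real.log_mul (Real.exp_ne_zero _) hN.ne', Real.log_mul (Real.exp_ne_zero _) hD.ne',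
    Real.log_exp, Real.log_exp] at hlog
  rw [hηt, hQ, Real.log_div hN.ne' hD.ne']
  linarith
end

section
/- Let (Ω, F, P) be a probability space, let ε be a real random variable whose law is the standard Gaussian N(0,1), and let ω be a random variable taking values in {0,1} that is independent of ε, with P(ω = 1) = 1 - p₀₀ where 0 ≤ p₀₀ ≤ 1. Let r, λ_E, λ_χ, μ, ψ, γˢ, ψˢ be real numbers, v > 0, and η > 0. Define ξ := -log E[exp(-λ_χ · ω)], the pricing kernel Λ := exp(-r - λ_E²/2 - λ_E · ε - λ_χ · ω + ξ), the risk-adjusted probability p̃₀₀ := p₀₀ / (p₀₀ + (1 - p₀₀) · e^{-λ_χ}), and the risk-adjusted peg premium η̃ := -log(e^{-η} + p̃₀₀ · (1 - e^{-η})). If both Euler equations E[Λ · exp(ψ + μ + √v · ε)] = 1 and E[Λ · exp(γˢ + ψˢ + μ + √v · ε - η · ω)] = 1 hold, then ψˢ = ψ - γˢ + η̃. -/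
open MeasureTheory ProbabilityTheory

/-- The exponential moment of a Bernoulli variable with success probability `1 - p`. -/
lemma integral_exp_mul_of_bernoulli {Ω : Type*} [MeasurableSpace Ω] {P : Measure Ω}
    [IsProbabilityMeasure P] {ω : Ω → ℝ} (hωm : Measurable ω)
    (hω01 : ∀ x, ω x = 0 ∨ ω x = 1) {p : ℝ} (hp1 : p ≤ 1)
    (hPω : P {x | ω x = 1} = ENNReal.ofReal (1 - p)) (t : ℝ) :
    ∫ x, Real.exp (t * ω x) ∂P = p + (1 - p) * Real.exp t := by
  have hms : MeasurableSet {x | ω x = 1} := hωm (measurableSet_singleton 1)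
  have hexp : ∀ x, Real.exp (t * ω x) =
      1 + {x | ω x = 1}.indicator (fun _ => Real.exp t - 1) x := by
    intro x
    rcases hω01 x with h | h <;> simp [h]
  have hreal : P.real {x | ω x = 1} = 1 - p := by
    rw [measureReal_def, hPω, ENNReal.toReal_ofReal (by linarith)]
  simp_rw [hexp]
  rw [integral_add (integrable_const _) ((integrable_const _).indicator hms),
    integral_indicator_const _ hms, hreal]
  simp
  ring

/-- For independent variables the exponential of an affine combination factors in expectation. -/
lemma integral_exp_affine_of_indepFun {Ω : Type*} [MeasurableSpace Ω] {P : Measure Ω}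
    {X Y : Ω → ℝ} (hX : Measurable X) (hY : Measurable Y) (h : IndepFun X Y P) (c s t : ℝ) :
    ∫ x, Real.exp (c + s * X x + t * Y x) ∂P =
      Real.exp c * ((∫ x, Real.exp (s * X x) ∂P) * ∫ x, Real.exp (t * Y x) ∂P) := by
  have hind : IndepFun (fun x => Real.exp (s * X x)) (fun x => Real.exp (t * Y x)) P :=
    h.comp (φ := fun y => Real.exp (s * y)) (ψ := fun y => Real.exp (t * y))
      (by fun_prop) (by fun_prop)
  rw [← hind.integral_fun_mul_eq_mul_integral (by fun_prop) (by fun_prop),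
    ← integral_const_mul]
  simp_rw [Real.exp_add, mul_assoc]

/-- Proposition 5 (stETH lending vs. ETH lending), parity state: if the Euler
equations hold for both the ETH lending return `exp(ψ + μ + √v ε)` and the
liquid-staking return `exp(γˢ + ψˢ + μ + √v ε - η ω)` under the pricing kernel
`Λ = exp(-r - λ_E²/2 - λ_E ε - λ_χ ω + ξ)`, then `ψˢ = ψ - γˢ + η̃`. -/
theorem steth_vs_lending_parity
    {Ω : Type*} [MeasurableSpace Ω] (P : Measure Ω) [IsProbabilityMeasure P]
    (ε ω : Ω → ℝ) (hεm : Measurable ε) (hωm : Measurable ω)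
    (hεlaw : Measure.map ε P = gaussianReal 0 1)
    (hω01 : ∀ x, ω x = 0 ∨ ω x = 1)
    (hindep : IndepFun ε ω P)
    (p00 : ℝ) (hp0 : 0 ≤ p00) (hp1 : p00 ≤ 1)
    (hPω : P {x | ω x = 1} = ENNReal.ofReal (1 - p00))
    (r lamE lamχ μ ψ γs ψs v η : ℝ) (hv : 0 < v) (hη : 0 < η)
    (ξ : ℝ) (hξ : ξ = -Real.log (∫ x, Real.exp (-lamχ * ω x) ∂P))
    (Λ : Ω → ℝ)
    (hΛ : ∀ x, Λ x = Real.exp (-r - lamE ^ 2 / 2 - lamE * ε x - lamχ * ω x + ξ))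
    (ptilde : ℝ) (hpt : ptilde = p00 / (p00 + (1 - p00) * Real.exp (-lamχ)))
    (ηtilde : ℝ)
    (hηt : ηtilde = -Real.log (Real.exp (-η) + ptilde * (1 - Real.exp (-η))))
    (hEuler1 : ∫ x, Λ x * Real.exp (ψ + μ + Real.sqrt v * ε x) ∂P = 1)
    (hEuler2 : ∫ x, Λ x * Real.exp (γs + ψs + μ + Real.sqrt v * ε x - η * ω x) ∂P = 1) :
    ψs = ψ - γs + ηtilde := by
  set k : ℝ := -r - lamE ^ 2 / 2 + ξ + μ with hk
  have h1 : ∫ x, Real.exp ((k + ψ) + (Real.sqrt v - lamE) * ε x + (-lamχ) * ω x) ∂P = 1 := by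
    rw [← hEuler1]
    congr 1 with x
    rw [hΛ, ← Real.exp_add]
    congr 1
    rw [hk]
    ring
  have h2 : ∫ x, Real.exp ((k + (γs + ψs)) + (Real.sqrt v - lamE) * ε x
      + (-lamχ - η) * ω x) ∂P = 1 := by
    rw [← hEuler2]
    congr 1 with x
    rw [hΛ, ← Real.exp_add]
    congr 1
    rw [hk]
    ring
  rw [integral_exp_affine_of_indepFun hεm hωm hindep,
    integral_exp_mul_of_bernoulli hωm hω01 hp1 hPω] at h1 h2
  set G := ∫ x, Real.exp ((Real.sqrt v - lamE) * ε x) ∂P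
  have hpos : ∀ t : ℝ, 0 < p00 + (1 - p00) * Real.exp t := by
    intro t
    rcases hp0.eq_or_lt with h | h
    · rw [← h]
      simp [Real.exp_pos]
    · have := mul_nonneg (sub_nonneg.2 hp1) (Real.exp_pos t).le
      linarith
  have hA := hpos (-lamχ)
  have hB := hpos (-lamχ - η)
  have hG : G ≠ 0 := by
    intro h
    simp [h] at h1
  have hratio : Real.exp ψ * (p00 + (1 - p00) * Real.exp (-lamχ)) =
      Real.exp (γs + ψs) * (p00 + (1 - p00) * Real.exp (-lamχ - η)) := by
    rw [Real.exp_add k] at h1 h2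
    apply mul_left_cancel₀ (mul_ne_zero (Real.exp_pos k).ne' hG)
    linear_combination h1 - h2
  have hlog := congrArg Real.log hratio
  rw [Real.log_mul (Real.exp_pos _).ne' hA.ne', Real.log_mul (Real.exp_pos _).ne' hB.ne',
    Real.log_exp, Real.log_exp] at hlog
  have hpeg : Real.exp (-η) + ptilde * (1 - Real.exp (-η)) =
      (p00 + (1 - p00) * Real.exp (-lamχ - η)) / (p00 + (1 - p00) * Real.exp (-lamχ)) := by
    rw [hpt, sub_eq_add_neg (-lamχ), Real.exp_add]
    field_simp
    ring
  rw [hηt, hpeg, Real.log_div hB.ne' hA.ne']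
  linarith
end
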